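/- Let n be a non-negative integer and let W: H → ℂ be a function that is left-invariant under U_H and right-invariant under K_{n,H}. Let s ∈ ℂ with Re(s) < 1 be such that ∫_{E^×} |W(t(a))|·|a|_E^{−Re(s)} d^×a < ∞. Then Z(1−s, W, Φ̂_n) = q^{−2n(s−1/2)}·Z(1−s, W, Φ_n), where for Ψ ∈ S(F²), Z(1−s, W, Ψ) = ∫_{E^×} ∫_{K_{n,H}} W(t(a)k)·f(1−s, t(a)k, Ψ)·|a|_E^{-1} d^×a dk. -/

import Mathlib

set_option autoImplicit false

open MeasureTheory Matrix

noncomputable section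

/-- The zeta integral `z(s, g, Φ) = ∫_{F^×} (gΦ)(0,r) |r|_E^s d^×r`, where
`|r|_E = |r|_F^2` and `d^×r` is the measure `μ`. -/
def zInt {F : Type} [Field F] [MeasurableSpace F] (μ : Measure F)
    (absF : F → ℝ) (s : ℂ) (g : Matrix (Fin 2) (Fin 2) F) (Φ : F × F → ℂ) : ℂ :=
  ∫ r, Φ (r * g 1 0, r * g 1 1) * Complex.ofReal (absF r ^ 2) ^ s ∂μ

/-- `Φ_n`, the characteristic function of `p_F^n ⊕ o_F`. -/
def PhiN {F : Type} [Field F] (q : ℝ) (absF : F → ℝ) (n : ℤ) : F × F → ℂ :=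
  fun p => if absF p.1 ≤ q ^ (-n) ∧ absF p.2 ≤ 1 then 1 else 0

/-- `L_E(s, 1) = 1 / (1 - q^{-2s})`. -/
def LEfac (q : ℝ) (s : ℂ) : ℂ := 1 / (1 - (q : ℂ) ^ (-2 * s))

/-- The Fourier transform `Φ̂(x,y) = ∫_{F²} Φ(u,v) ψ(yu - xv) du dv`. -/
def FHat {F : Type} [Field F] [MeasurableSpace F] (μa : Measure F)
    (ψF : F → ℂ) (Φ : F × F → ℂ) : F × F → ℂ :=
  fun p => ∫ w : F × F, Φ w * ψF (p.2 * w.1 - p.1 * w.2) ∂(μa.prod μa)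

/-- The second Fourier transform `Φ*(x,y) = ∫_{F²} Φ(u,v) ψ(yu + xv) du dv`. -/
def PhiSt {F : Type} [Field F] [MeasurableSpace F] (μa : Measure F)
    (ψF : F → ℂ) (Φ : F × F → ℂ) : F × F → ℂ :=
  fun p => ∫ w : F × F, Φ w * ψF (p.2 * w.1 + p.1 * w.2) ∂(μa.prod μa)

/-- `t(a) = diag(a, conj(a)⁻¹)`. -/
def tdiag {E : Type} [Field E] (σ : E → E) (a : E) : Matrix (Fin 2) (Fin 2) E :=
  !![a, 0; 0, (σ a)⁻¹]

/-- `d(c) = diag(c, 1)`. -/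
def ddiag {E : Type} [Field E] (c : E) : Matrix (Fin 2) (Fin 2) E := !![c, 0; 0, 1]

/-- `H = U(1,1)(E/F) = {h : ᵗh̄ J₂ h = J₂}` with `J₂` the 2×2 antidiagonal matrix. -/
def HsetM {E : Type} [Field E] (σ : E → E) : Set (Matrix (Fin 2) (Fin 2) E) :=
  {m | (m.map σ)ᵀ * !![(0 : E), 1; 1, 0] * m = !![(0 : E), 1; 1, 0]}

/-- `U_H`, the upper triangular unipotent subgroup of `H`. -/
def UHsetM {E : Type} [Field E] (σ : E → E) : Set (Matrix (Fin 2) (Fin 2) E) :=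
  {m | ∃ y : E, y + σ y = 0 ∧ m = !![1, y; 0, 1]}

/-- `K_{n,H} = {(a,b;c,d) ∈ H : a, d ∈ o_E, b ∈ p_E^{-n}, c ∈ p_E^n}`. -/
def KHset {E : Type} [Field E] (q : ℝ) (σ : E → E) (absE : E → ℝ) (n : ℤ) :
    Set (Matrix (Fin 2) (Fin 2) E) :=
  {m | m ∈ HsetM σ ∧ absE (m 0 0) ≤ 1 ∧ absE (m 1 1) ≤ 1 ∧
    absE (m 0 1) ≤ (q ^ 2) ^ n ∧ absE (m 1 0) ≤ (q ^ 2) ^ (-n)}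

/-- `h = t(b) d(√ε) h₁ d(√ε)⁻¹` is a decomposition of `h` with `b ∈ E^×` and
`h₁ ∈ SL₂(F)`. -/
def IsDecomp {F E : Type} [Field F] [Field E] [Algebra F E] (σ : E → E) (sqrtε : E)
    (b : E) (h₁ : Matrix (Fin 2) (Fin 2) F) (h : Matrix (Fin 2) (Fin 2) E) : Prop :=
  b ≠ 0 ∧ h₁.det = 1 ∧
    h = tdiag σ b * ddiag sqrtε * h₁.map (algebraMap F E) * ddiag sqrtε⁻¹

theorem aux_decomp {F E : Type} [Field F] [CharZero F] [Field E] [Algebra F E] (σ : E → E)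
    (hσadd : ∀ x y : E, σ (x + y) = σ x + σ y)
    (hσmul : ∀ x y : E, σ (x * y) = σ x * σ y)
    (hσinvol : ∀ x : E, σ (σ x) = x)
    (hσfix : ∀ x : F, σ (algebraMap F E x) = algebraMap F E x)
    (sqrtε : E) (hne : sqrtε ≠ 0)
    (hσsqrtε : σ sqrtε = -sqrtε)
    (hspan : ∀ x : E, ∃ a b : F, x = algebraMap F E a + algebraMap F E b * sqrtε)
    (h : Matrix (Fin 2) (Fin 2) E) (hh : h ∈ HsetM σ) :
    ∃ (b : E) (h₁ : Matrix (Fin 2) (Fin 2) F), IsDecomp σ sqrtε b h₁ h := by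
  have inj : Function.Injective (algebraMap F E) := (algebraMap F E).injective
  have h2 : (2 : E) ≠ 0 := by
    have : algebraMap F E 2 ≠ 0 := by
      rw [Ne, map_eq_zero]; exact two_ne_zero
    rwa [map_ofNat] at this
  have fixed : ∀ x : E, σ x = x → ∃ a : F, algebraMap F E a = x := by
    intro x hx
    obtain ⟨a, b, rfl⟩ := hspan x
    refine ⟨a, ?_⟩
    rw [hσadd, hσmul, hσfix, hσfix, hσsqrtε] at hx
    have : 2 * (algebraMap F E b * sqrtε) = 0 := by linear_combination -hx
    rcases mul_eq_zero.1 this with h | h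
    · exact absurd h h2
    · rw [h, add_zero]
  have σ0 : σ 0 = 0 := by simpa using hσadd 0 0
  have σz : ∀ x, σ x = 0 → x = 0 := by
    intro x hx; rw [← hσinvol x, hx, σ0]
  have σ1 : σ 1 = 1 := by simpa using hσfix 1
  have σinv : ∀ x, σ x⁻¹ = (σ x)⁻¹ := by
    intro x
    by_cases hx : x = 0
    · simp [hx, σ0]
    · apply eq_inv_of_mul_eq_one_left
      rw [← hσmul, inv_mul_cancel₀ hx, σ1]
  have σneg : ∀ x, σ (-x) = - σ x := by
    intro x
    have := hσadd x (-x)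
    rw [add_neg_cancel, σ0] at this
    linear_combination -this
  obtain ⟨A, B, C, D, rfl⟩ : ∃ A B C D, h = !![A, B; C, D] :=
    ⟨_, _, _, _, Matrix.eta_fin_two h⟩
  simp only [HsetM, Set.mem_ofPred_eq] at hh
  have e00 := congrFun (congrFun hh 0) 0
  have e01 := congrFun (congrFun hh 0) 1
  have e11 := congrFun (congrFun hh 1) 1
  simp [Matrix.mul_apply, Fin.sum_univ_two] at e00 e01 e11
  have e10 : A * σ D + C * σ B = 1 := by
    have := congrArg σ e01
    simp only [hσadd, hσmul, hσinvol, σ1] at this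
    linear_combination this
  by_cases hA : A = 0
  · subst hA
    simp only [σ0] at *
    have hB : B ≠ 0 := by rintro rfl; simp at e01
    have hsB : σ B ≠ 0 := fun h => hB (σz _ h)
    have hC : C ≠ 0 := by rintro rfl; simp at e10
    obtain ⟨w, hw⟩ := fixed (-(D * σ B / sqrtε)) (by
      rw [div_eq_mul_inv]
      simp only [σneg, hσmul, σinv, hσinvol, hσsqrtε]
      field_simp
      linear_combination e11)
    refine ⟨B / sqrtε, !![0, 1; -1, w], div_ne_zero hB hne, by simp, ?_⟩
    have hσb : σ (B / sqrtε) = - (σ B / sqrtε) := by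
      rw [div_eq_mul_inv, hσmul, σinv, hσsqrtε]; field_simp
    ext i j
    fin_cases i <;> fin_cases j <;>
      simp [tdiag, ddiag, Matrix.mul_apply, Fin.sum_univ_two, Matrix.vecMul, dotProduct, hσb, hw] <;> field_simp
    linear_combination e10
  · have hsA : σ A ≠ 0 := fun h => hA (σz _ h)
    have eB : σ B * A + B * σ A = 0 := by
      linear_combination (A * σ A) * e11 - (σ B * A) * e01 - (B * σ A) * e10
        + (B * σ B) * e00
    obtain ⟨y, hy⟩ := fixed (B / A / sqrtε) (by
      simp only [div_eq_mul_inv, hσmul, σinv, hσsqrtε]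
      field_simp
      linear_combination -eB)
    obtain ⟨z, hz⟩ := fixed (sqrtε * C * σ A) (by
      simp only [hσmul, hσinvol, hσsqrtε]
      linear_combination (-sqrtε) * e00)
    obtain ⟨w, hw⟩ := fixed (D * σ A) (by
      simp only [hσmul, hσinvol]
      have : A * (σ D * A - D * σ A) = 0 := by
        linear_combination A * e10 - A * e01 + B * e00 - C * eB
      rcases mul_eq_zero.1 this with h | h
      · exact absurd h hA
      · linear_combination h)
    refine ⟨A, !![1, y; z, w], hA, ?_, ?_⟩
    · apply inj
      simp [hy, hz, hw]
      field_simp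
      linear_combination A * e01 - B * e00
    · ext i j
      fin_cases i <;> fin_cases j <;>
        simp [tdiag, ddiag, Matrix.mul_apply, Fin.sum_univ_two, Matrix.vecMul, dotProduct, hy, hz, hw] <;> field_simp

theorem aux_ball {F : Type} [Field F]
    (q : ℝ) (hq : 1 < q)
    (absF : F → ℝ)
    (habsF0 : ∀ x : F, absF x = 0 ↔ x = 0)
    (habsFmul : ∀ x y : F, absF (x * y) = absF x * absF y)
    (habsFadd : ∀ x y : F, absF (x + y) ≤ max (absF x) (absF y))
    (ϖ : F) (hϖ : absF ϖ = q⁻¹)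
    (hvalF : ∀ x : F, x ≠ 0 → ∃ m : ℤ, absF x = q ^ m)
    [MeasurableSpace F]
    (habsFmeas : Measurable absF)
    (hFmulmeas : Measurable fun p : F × F => p.1 * p.2)
    (hFaddmeas : Measurable fun p : F × F => p.1 + p.2)
    (μa : Measure F)
    (hμaadd : ∀ v : F, Measure.map (fun x => x + v) μa = μa)
    (hμasc : ∀ a : F, a ≠ 0 →
      Measure.map (fun x => a * x) μa = ENNReal.ofReal ((absF a)⁻¹) • μa)
    (hμa1 : μa {x : F | absF x ≤ 1} = 1)
    (ψF : F → ℂ)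
    (hψadd : ∀ x y : F, ψF (x + y) = ψF x * ψF y)
    (hψtriv : ∀ x : F, absF x ≤ 1 → ψF x = 1)
    (hψnontriv : ∃ x : F, absF x ≤ q ∧ ψF x ≠ 1) (m : ℕ) (c : F) :
    (∫ u, (if absF u ≤ q ^ (-(m : ℤ)) then (1 : ℂ) else 0) * ψF (c * u) ∂μa)
      = if absF c ≤ q ^ (m : ℤ) then (q : ℂ) ^ (-(m : ℤ)) else 0 := by
  have hq0 : (0 : ℝ) < q := by linarith
  have hqm : (0 : ℝ) < q ^ (m : ℤ) := by positivity
  have hnn : ∀ x, 0 ≤ absF x := by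
    intro x
    by_cases hx : x = 0
    · rw [(habsF0 x).2 hx]
    · obtain ⟨k, hk⟩ := hvalF x hx
      rw [hk]; positivity
  have h1 : absF 1 = 1 := by
    have h := habsFmul 1 1
    rw [mul_one] at h
    have h0 : absF 1 ≠ 0 := fun h => one_ne_zero ((habsF0 1).1 h)
    field_simp at h
    exact h.symm
  have hpow : absF (ϖ ^ m) = q ^ (-(m : ℤ)) := by
    induction m with
    | zero => simp [h1]
    | succ k ih =>
      rw [pow_succ, habsFmul, ih (by positivity), hϖ]
      rw [Nat.cast_succ, neg_add, zpow_add₀ hq0.ne', _root_.zpow_neg_one]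
  split_ifs with hc
  · have hball : μa {x | absF x ≤ q ^ (-(m : ℤ))} = ENNReal.ofReal (q ^ (-(m : ℤ))) := by
      have hne : ϖ ^ m ≠ 0 := by
        intro h
        rw [(habsF0 _).2 h] at hpow
        have : (0 : ℝ) < q ^ (-(m : ℤ)) := by positivity
        linarith
      have h := congrArg (fun ν => ν {x | absF x ≤ q ^ (-(m : ℤ))}) (hμasc (ϖ ^ m) hne)
      have hms : MeasurableSet {x | absF x ≤ q ^ (-(m : ℤ))} :=
        measurableSet_le habsFmeas measurable_const
      have hmm : Measurable fun x => ϖ ^ m * x :=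
        hFmulmeas.comp (measurable_const.prodMk measurable_id)
      simp only [Measure.smul_apply, smul_eq_mul] at h
      rw [Measure.map_apply hmm hms] at h
      have hpre : (fun x => ϖ ^ m * x) ⁻¹' {x | absF x ≤ q ^ (-(m : ℤ))}
          = {x | absF x ≤ 1} := by
        ext x
        simp only [Set.mem_preimage, Set.mem_ofPred_eq, habsFmul, hpow]
        have : (0 : ℝ) < q ^ (-(m : ℤ)) := by positivity
        constructor
        · intro h; nlinarith
        · intro h; nlinarith
      rw [hpre, hμa1, hpow, ← _root_.zpow_neg, neg_neg] at h
      have h3 := congrArg (fun t => ENNReal.ofReal (q ^ (-(m : ℤ))) * t) h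
      simp only [mul_one] at h3
      rw [← mul_assoc, ← ENNReal.ofReal_mul (by positivity), ← zpow_add₀ hq0.ne',
        neg_add_cancel, zpow_zero, ENNReal.ofReal_one, one_mul] at h3
      exact h3.symm
    have hfun : (fun u => (if absF u ≤ q ^ (-(m : ℤ)) then (1 : ℂ) else 0) * ψF (c * u))
        = Set.indicator {x | absF x ≤ q ^ (-(m : ℤ))} (fun _ => (1 : ℂ)) := by
      ext u
      simp only [Set.indicator_apply, Set.mem_ofPred_eq]
      split_ifs with hu
      · rw [one_mul]
        apply hψtriv
        rw [habsFmul]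
        calc absF c * absF u ≤ q ^ (m : ℤ) * q ^ (-(m : ℤ)) :=
              mul_le_mul hc hu (hnn u) hqm.le
          _ = 1 := by rw [← zpow_add₀ hq0.ne']; simp
      · simp
    rw [hfun, integral_indicator_const _ (measurableSet_le habsFmeas measurable_const)]
    rw [Measure.real, hball, ENNReal.toReal_ofReal (by positivity)]
    simp
  · obtain ⟨x0, hx0, hx1⟩ := hψnontriv
    push Not at hc
    have hc0 : c ≠ 0 := by
      intro h
      rw [(habsF0 c).2 h] at hc
      linarith
    have hu0 : absF (x0 / c) ≤ q ^ (-(m : ℤ)) := by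
      obtain ⟨k, hk⟩ := hvalF c hc0
      rw [hk] at hc
      have hmk : (m : ℤ) < k := (zpow_lt_zpow_iff_right₀ hq).1 hc
      have hge : q ^ (m + 1 : ℤ) ≤ absF c := by
        rw [hk]; exact (zpow_le_zpow_iff_right₀ hq).2 hmk
      have hmul : absF (x0 / c) * absF c = absF x0 := by
        rw [← habsFmul, div_mul_cancel₀ _ hc0]
      have h4 : absF (x0 / c) * q ^ (m + 1 : ℤ) ≤ q := by
        calc _ ≤ absF (x0 / c) * absF c := mul_le_mul_of_nonneg_left hge (hnn _)
          _ ≤ q := by rw [hmul]; exact hx0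
      rw [zpow_add₀ hq0.ne', zpow_one, ← mul_assoc] at h4
      have h5 : absF (x0 / c) * q ^ (m : ℤ) ≤ 1 := by
        by_contra hcon
        push Not at hcon
        nlinarith
      rw [_root_.zpow_neg, ← one_div, le_div_iff₀ hqm]
      exact h5
    have hneg : ∀ x, absF (-x) = absF x := by
      intro x
      have hsq : absF (-1) * absF (-1) = 1 := by rw [← habsFmul]; simp [h1]
      have : absF (-1) = 1 := by nlinarith [hnn (-1)]
      rw [neg_eq_neg_one_mul, habsFmul, this, one_mul]
    have hiff : ∀ u, absF (u + x0 / c) ≤ q ^ (-(m : ℤ)) ↔ absF u ≤ q ^ (-(m : ℤ)) := by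
      intro u
      constructor
      · intro h
        have := habsFadd (u + x0 / c) (-(x0 / c))
        rw [add_neg_cancel_right, hneg] at this
        exact this.trans (max_le h hu0)
      · intro h
        exact (habsFadd _ _).trans (max_le h hu0)
    have hadd : ∀ v : F, Measurable fun x => x + v := fun v =>
      hFaddmeas.comp (measurable_id.prodMk measurable_const)
    let e : F ≃ᵐ F :=
      { toFun := fun x => x + x0 / c
        invFun := fun x => x + -(x0 / c)
        left_inv := fun x => by simp
        right_inv := fun x => by simp
        measurable_toFun := hadd _
        measurable_invFun := hadd _ }
    have key := e.measurableEmbedding.integral_map (μ := μa)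
      (fun u => (if absF u ≤ q ^ (-(m : ℤ)) then (1 : ℂ) else 0) * ψF (c * u))
    have he : (e : F → F) = fun x => x + x0 / c := rfl
    rw [he, hμaadd] at key
    have hfun : ∀ u, (if absF (u + x0 / c) ≤ q ^ (-(m : ℤ)) then (1 : ℂ) else 0)
        * ψF (c * (u + x0 / c)) = ψF x0 *
        ((if absF u ≤ q ^ (-(m : ℤ)) then (1 : ℂ) else 0) * ψF (c * u)) := by
      intro u
      rw [mul_add, mul_div_cancel₀ _ hc0, hψadd]
      simp only [hiff]
      ring
    simp only [hfun] at key
    rw [integral_const_mul] at key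
    have hz : (1 - ψF x0) * (∫ u, (if absF u ≤ q ^ (-(m : ℤ)) then (1 : ℂ) else 0)
        * ψF (c * u) ∂μa) = 0 := by linear_combination key
    rcases mul_eq_zero.1 hz with h | h
    · exact absurd (by linear_combination -h) hx1
    · exact h

/-- If `W` is left `U_H`-invariant and right `K_{n,H}`-invariant, `Re(s) < 1`, and
`∫_{E^×} |W(t(a))| |a|_E^{-Re(s)} d^×a < ∞`, then
`Z(1-s, W, Φ̂_n) = q^{-2n(s-1/2)} Z(1-s, W, Φ_n)`. -/
theorem stmt_7
    (F : Type) [Field F] [CharZero F]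
    (q : ℝ) (hq : 1 < q)
    (absF : F → ℝ)
    (habsF0 : ∀ x : F, absF x = 0 ↔ x = 0)
    (habsFmul : ∀ x y : F, absF (x * y) = absF x * absF y)
    (habsFadd : ∀ x y : F, absF (x + y) ≤ max (absF x) (absF y))
    (ϖ : F) (hϖ : absF ϖ = q⁻¹)
    (hvalF : ∀ x : F, x ≠ 0 → ∃ m : ℤ, absF x = q ^ m)
    (habsF2 : absF 2 = 1)
    [MeasurableSpace F]
    (habsFmeas : Measurable absF)
    (hFmulmeas : Measurable fun p : F × F => p.1 * p.2)
    (hFaddmeas : Measurable fun p : F × F => p.1 + p.2)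
    (μ : Measure F) [SigmaFinite μ]
    (hμ0 : μ {0} = 0)
    (hμinv : ∀ a : F, a ≠ 0 → Measure.map (fun x => a * x) μ = μ)
    (hμ1 : μ {x : F | absF x = 1} = 1)
    (μa : Measure F) [SigmaFinite μa]
    (hμaadd : ∀ v : F, Measure.map (fun x => x + v) μa = μa)
    (hμasc : ∀ a : F, a ≠ 0 →
      Measure.map (fun x => a * x) μa = ENNReal.ofReal ((absF a)⁻¹) • μa)
    (hμa1 : μa {x : F | absF x ≤ 1} = 1)
    (ψF : F → ℂ) (hψmeas : Measurable ψF)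
    (hψadd : ∀ x y : F, ψF (x + y) = ψF x * ψF y)
    (hψtriv : ∀ x : F, absF x ≤ 1 → ψF x = 1)
    (hψnontriv : ∃ x : F, absF x ≤ q ∧ ψF x ≠ 1)
    (E : Type) [Field E] [Algebra F E]
    (σ : E → E)
    (hσadd : ∀ x y : E, σ (x + y) = σ x + σ y)
    (hσmul : ∀ x y : E, σ (x * y) = σ x * σ y)
    (hσinvol : ∀ x : E, σ (σ x) = x)
    (hσfix : ∀ x : F, σ (algebraMap F E x) = algebraMap F E x)
    (ε : F) (sqrtε : E)
    (hεabs : absF ε = 1)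
    (hεnonsq : ∀ a : F, a * a ≠ ε)
    (hsqrtε : sqrtε * sqrtε = algebraMap F E ε)
    (hσsqrtε : σ sqrtε = -sqrtε)
    (hspan : ∀ x : E, ∃ a b : F, x = algebraMap F E a + algebraMap F E b * sqrtε)
    (absE : E → ℝ)
    (habsE0 : ∀ x : E, absE x = 0 ↔ x = 0)
    (habsEmul : ∀ x y : E, absE (x * y) = absE x * absE y)
    (habsEadd : ∀ x y : E, absE (x + y) ≤ max (absE x) (absE y))
    (habsEF : ∀ x : F, absE (algebraMap F E x) = absF x ^ 2)
    (habsEconj : ∀ x : E, absE (σ x) = absE x)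
    (habsEspan : ∀ a b : F,
      absE (algebraMap F E a + algebraMap F E b * sqrtε) = max (absF a ^ 2) (absF b ^ 2))
    (hvalE : ∀ x : E, x ≠ 0 → ∃ m : ℤ, absE x = (q ^ 2) ^ m)
    [MeasurableSpace E]
    (habsEmeas : Measurable absE) (hσmeas : Measurable σ)
    (hEmulmeas : Measurable fun p : E × E => p.1 * p.2)
    (μE : Measure E) [SigmaFinite μE]
    (hμE0 : μE {0} = 0)
    (hμEinv : ∀ a : E, a ≠ 0 → Measure.map (fun x => a * x) μE = μE)
    (hμE1 : μE {x : E | absE x = 1} = 1)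
    (n : ℕ)
    [MeasurableSpace (Matrix (Fin 2) (Fin 2) E)]
    (κ : Measure (Matrix (Fin 2) (Fin 2) E)) [SigmaFinite κ]
    (hκmeas : MeasurableSet (KHset q σ absE (n : ℤ)))
    (hκ1 : κ (KHset q σ absE (n : ℤ)) = 1)
    (hκcompl : κ ((KHset q σ absE (n : ℤ))ᶜ) = 0)
    (fE : ℂ → Matrix (Fin 2) (Fin 2) E → (F × F → ℂ) → ℂ)
    (hfE : ∀ (s : ℂ) (h : Matrix (Fin 2) (Fin 2) E) (Φ : F × F → ℂ)
      (b : E) (h₁ : Matrix (Fin 2) (Fin 2) F), IsDecomp σ sqrtε b h₁ h →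
      fE s h Φ = Complex.ofReal (absE b) ^ s * zInt μ absF s h₁ Φ)
    (W : Matrix (Fin 2) (Fin 2) E → ℂ)
    (hWU : ∀ u ∈ UHsetM σ, ∀ h ∈ HsetM σ, W (u * h) = W h)
    (hWK : ∀ h ∈ HsetM σ, ∀ k ∈ KHset q σ absE (n : ℤ), W (h * k) = W h)
    (s : ℂ) (hs : s.re < 1)
    (hWmeas : AEStronglyMeasurable (fun a : E => W (tdiag σ a)) μE)
    (hWconv : Integrable (fun a : E => ‖W (tdiag σ a)‖ * absE a ^ (-s.re)) μE) :
    (∫ a : E, (∫ k, W (tdiag σ a * k) *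
        fE (1 - s) (tdiag σ a * k) (FHat μa ψF (PhiN q absF (n : ℤ))) ∂κ) *
        Complex.ofReal ((absE a)⁻¹) ∂μE)
      = (q : ℂ) ^ (-2 * (n : ℂ) * (s - 1 / 2)) *
        (∫ a : E, (∫ k, W (tdiag σ a * k) *
          fE (1 - s) (tdiag σ a * k) (PhiN q absF (n : ℤ)) ∂κ) *
          Complex.ofReal ((absE a)⁻¹) ∂μE) := by
  have hq0 : (0 : ℝ) < q := by linarith
  have hnn : ∀ x, 0 ≤ absF x := by
    intro x
    by_cases hx : x = 0
    · rw [(habsF0 x).2 hx]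
    · obtain ⟨k, hk⟩ := hvalF x hx
      rw [hk]; positivity
  have h1 : absF 1 = 1 := by
    have h := habsFmul 1 1
    rw [mul_one] at h
    have h0 : absF 1 ≠ 0 := fun h => one_ne_zero ((habsF0 1).1 h)
    field_simp at h
    exact h.symm
  have hneg : ∀ x, absF (-x) = absF x := by
    intro x
    have hsq : absF (-1) * absF (-1) = 1 := by rw [← habsFmul]; simp [h1]
    have : absF (-1) = 1 := by nlinarith [hnn (-1)]
    rw [neg_eq_neg_one_mul, habsFmul, this, one_mul]
  have hpow : ∀ m : ℕ, absF (ϖ ^ m) = q ^ (-(m : ℤ)) := by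
    intro m
    induction m with
    | zero => simp [h1]
    | succ k ih =>
      rw [pow_succ, habsFmul, ih, hϖ]
      rw [Nat.cast_succ, neg_add, zpow_add₀ hq0.ne', _root_.zpow_neg_one]
  have hne : sqrtε ≠ 0 := by
    rintro rfl
    rw [mul_zero] at hsqrtε
    have : ε = 0 := (map_eq_zero (algebraMap F E)).1 hsqrtε.symm
    rw [(habsF0 ε).2 this] at hεabs
    exact zero_ne_one hεabs
  have hball := aux_ball q hq absF habsF0 habsFmul habsFadd ϖ hϖ hvalF habsFmeas hFmulmeas
    hFaddmeas μa hμaadd hμasc hμa1 ψF hψadd hψtriv hψnontriv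
  have hϖn : ϖ ^ n ≠ 0 := by
    intro h
    have h2 := hpow n
    rw [(habsF0 _).2 h] at h2
    have : (0 : ℝ) < q ^ (-(n : ℤ)) := by positivity
    linarith
  have hhat : ∀ x y : F, FHat μa ψF (PhiN q absF (n : ℤ)) (x, y)
      = (q : ℂ) ^ (-(n : ℤ)) * PhiN q absF (n : ℤ) (ϖ ^ n * x, ϖ ^ n * y) := by
    intro x y
    have e1 : FHat μa ψF (PhiN q absF (n : ℤ)) (x, y) =
        (∫ u, (if absF u ≤ q ^ (-(n : ℤ)) then (1 : ℂ) else 0) * ψF (y * u) ∂μa) *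
        (∫ u, (if absF u ≤ q ^ (-((0 : ℕ) : ℤ)) then (1 : ℂ) else 0) * ψF (-x * u) ∂μa) := by
      rw [← integral_prod_mul]
      unfold FHat PhiN
      refine integral_congr_ae (Filter.Eventually.of_forall fun w => ?_)
      have : y * w.1 - x * w.2 = y * w.1 + -x * w.2 := by ring
      simp only [this, hψadd, Nat.cast_zero, neg_zero, zpow_zero]
      by_cases ha : absF w.1 ≤ q ^ (-(n : ℤ)) <;> by_cases hb : absF w.2 ≤ 1 <;> simp [ha, hb]
    rw [e1, hball, hball, hneg]
    unfold PhiN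
    have hp : (0 : ℝ) < q ^ (-(n : ℤ)) := by positivity
    have i1 : absF (ϖ ^ n * x) ≤ q ^ (-(n : ℤ)) ↔ absF x ≤ 1 := by
      rw [habsFmul, hpow]
      constructor <;> intro h <;> nlinarith
    have i2 : absF (ϖ ^ n * y) ≤ 1 ↔ absF y ≤ q ^ (n : ℤ) := by
      rw [habsFmul, hpow, _root_.zpow_neg, inv_mul_le_iff₀ (by positivity), mul_one]
    simp only [i1, i2, Nat.cast_zero, neg_zero, zpow_zero]
    by_cases ha : absF x ≤ 1 <;> by_cases hb : absF y ≤ q ^ (n : ℤ) <;> simp [ha, hb]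
  have hz : ∀ g : Matrix (Fin 2) (Fin 2) F,
      zInt μ absF (1 - s) g (FHat μa ψF (PhiN q absF (n : ℤ)))
      = (q : ℂ) ^ (-2 * (n : ℂ) * (s - 1 / 2)) *
        zInt μ absF (1 - s) g (PhiN q absF (n : ℤ)) := by
    intro g
    have hmul : ∀ v : F, Measurable fun x => v * x := fun v =>
      hFmulmeas.comp (measurable_const.prodMk measurable_id)
    let e : F ≃ᵐ F :=
      { toFun := fun x => ϖ ^ n * x
        invFun := fun x => (ϖ ^ n)⁻¹ * x
        left_inv := fun x => by field_simp
        right_inv := fun x => by field_simp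
        measurable_toFun := hmul _
        measurable_invFun := hmul _ }
    have key := e.measurableEmbedding.integral_map (μ := μ)
      (fun r => PhiN q absF (n : ℤ) (r * g 1 0, r * g 1 1)
        * Complex.ofReal (absF r ^ 2) ^ (1 - s))
    have he : (e : F → F) = fun x => ϖ ^ n * x := rfl
    rw [he, hμinv _ hϖn] at key
    unfold zInt
    rw [key, ← integral_const_mul]
    refine integral_congr_ae (Filter.Eventually.of_forall fun r => ?_)
    have hqc : (q : ℂ) ≠ 0 := by exact_mod_cast hq0.ne'
    have hc : Complex.ofReal (absF (ϖ ^ n * r) ^ 2) ^ (1 - s)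
        = (q : ℂ) ^ (-2 * (n : ℂ) * (1 - s)) * Complex.ofReal (absF r ^ 2) ^ (1 - s) := by
      rw [habsFmul, hpow, mul_pow, Complex.ofReal_mul,
        Complex.mul_cpow_ofReal_nonneg (by positivity) (by positivity)]
      congr 1
      have e3 : (q ^ (-(n : ℤ))) ^ 2 = q ^ (-2 * (n : ℝ)) := by
        rw [← zpow_natCast, ← _root_.zpow_mul, ← Real.rpow_intCast]
        congr 1
        push_cast
        ring
      rw [e3, Real.rpow_def_of_pos hq0, Complex.cpow_def_of_ne_zero
        (by exact_mod_cast (Real.exp_pos _).ne'), Complex.cpow_def_of_ne_zero hqc,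
        ← Complex.ofReal_log (Real.exp_pos _).le, Real.log_exp, ← Complex.ofReal_log hq0.le]
      push_cast
      ring_nf
    have hqq : (q : ℂ) ^ (-(n : ℤ)) = (q : ℂ) ^ (-2 * (n : ℂ) * (s - 1 / 2)) *
        (q : ℂ) ^ (-2 * (n : ℂ) * (1 - s)) := by
      rw [← Complex.cpow_add _ _ hqc, ← Complex.cpow_intCast]
      congr 1
      push_cast
      ring
    simp only [hhat, hc, hqq, mul_assoc]
    ring
  have hf : ∀ a : E, a ≠ 0 → ∀ k ∈ KHset q σ absE (n : ℤ),
      fE (1 - s) (tdiag σ a * k) (FHat μa ψF (PhiN q absF (n : ℤ)))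
      = (q : ℂ) ^ (-2 * (n : ℂ) * (s - 1 / 2)) *
        fE (1 - s) (tdiag σ a * k) (PhiN q absF (n : ℤ)) := by
    intro a ha k hk
    obtain ⟨b, h₁, hb, hdet, hdec⟩ := aux_decomp σ hσadd hσmul hσinvol hσfix sqrtε hne hσsqrtε
      hspan k hk.1
    have hd : IsDecomp σ sqrtε (a * b) h₁ (tdiag σ a * k) := by
      refine ⟨mul_ne_zero ha hb, hdet, ?_⟩
      have : tdiag σ (a * b) = tdiag σ a * tdiag σ b := by
        ext i j
        fin_cases i <;> fin_cases j <;> simp [tdiag, hσmul, mul_comm]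
      rw [hdec, this]
      simp only [Matrix.mul_assoc]
    rw [hfE _ _ _ _ _ hd, hfE _ _ _ _ _ hd, hz]
    ring
  rw [← integral_const_mul]
  have hae : ∀ᵐ a ∂μE, a ≠ 0 := by
    rw [ae_iff]; simpa using hμE0
  have haek : ∀ᵐ k ∂κ, k ∈ KHset q σ absE (n : ℤ) := by
    rw [ae_iff]; exact hκcompl
  refine integral_congr_ae ?_
  filter_upwards [hae] with a ha
  have : (∫ k, W (tdiag σ a * k) *
        fE (1 - s) (tdiag σ a * k) (FHat μa ψF (PhiN q absF (n : ℤ))) ∂κ)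
      = (q : ℂ) ^ (-2 * (n : ℂ) * (s - 1 / 2)) * ∫ k, W (tdiag σ a * k) *
          fE (1 - s) (tdiag σ a * k) (PhiN q absF (n : ℤ)) ∂κ := by
    rw [← integral_const_mul]
    refine integral_congr_ae ?_
    filter_upwards [haek] with k hk
    rw [hf a ha k hk]
    ring
  rw [this]
  ring
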